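/- arXiv:1010.4364 — 4 statements merged into one kernel-verified Lean document; each statement's English description precedes it below -/
import Mathlib

section
/- Let m be a positive integer prime to p and let η ∈ ℤ_p. Suppose that for every integer j with −m < j < m, the element η + j/m of ℤ_p (which is well defined since m is a unit in ℤ_p) is p-adically non-Liouville. Then m·η is p-adically non-Liouville; that is, liminf_{n→∞} ‖m·η + n‖^{1/n} = 1 and liminf_{n→∞} ‖m·η − n‖^{1/n} = 1. (This is the content established in the proof of Lemma 1.4 of the paper, in the case r = 1: only translates of η by the finitely many rationals j/m with |j| < m are needed.) -/
open Filter

/-- An element `α` of `ℤ_[p]` is *p-adically non-Liouville* if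
`liminf_{n→∞} ‖α + n‖^(1/n) = 1` and `liminf_{n→∞} ‖α - n‖^(1/n) = 1`,
where `n` runs over the positive integers. -/
def PNonLiouville (p : ℕ) [Fact p.Prime] (α : ℤ_[p]) : Prop :=
  Filter.liminf (fun n : ℕ => ‖α + (n : ℤ_[p])‖ ^ (1 / (n : ℝ))) Filter.atTop = 1 ∧
  Filter.liminf (fun n : ℕ => ‖α - (n : ℤ_[p])‖ ^ (1 / (n : ℝ))) Filter.atTop = 1

/-- The set `ℤ_(p)` of rational elements of `ℤ_[p]`: those elements which are the image
of a rational number under the canonical embedding `ℚ → ℚ_[p]`. -/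
def PadicRatSet (p : ℕ) [Fact p.Prime] : Set ℤ_[p] :=
  {x | ∃ q : ℚ, (x : ℚ_[p]) = (q : ℚ_[p])}

/-- `S ⊆ ℤ_[p]` is NID if for all `α, β ∈ S`, `α - β` is not a nonzero integer. -/
def IsNID (p : ℕ) [Fact p.Prime] (S : Set ℤ_[p]) : Prop :=
  ∀ α ∈ S, ∀ β ∈ S, ∀ k : ℤ, α - β = (k : ℤ_[p]) → k = 0

/-- `S ⊆ ℤ_[p]` is NRD if for all `α, β ∈ S`, `α - β` is not a nonzero element
of `ℤ_(p)`. -/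
def IsNRD (p : ℕ) [Fact p.Prime] (S : Set ℤ_[p]) : Prop :=
  ∀ α ∈ S, ∀ β ∈ S, α - β ∈ PadicRatSet p → α - β = 0

/-- `S ⊆ ℤ_[p]` is NLD if for all `α, β ∈ S`, `α - β` is p-adically non-Liouville. -/
def IsNLD (p : ℕ) [Fact p.Prime] (S : Set ℤ_[p]) : Prop :=
  ∀ α ∈ S, ∀ β ∈ S, PNonLiouville p (α - β)

/-- `S ⊆ ℤ_[p]` is SNLD if for all `α, β ∈ S` and all `a ∈ ℤ_(p)`,
`α - β + a` is p-adically non-Liouville. -/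
def IsSNLD (p : ℕ) [Fact p.Prime] (S : Set ℤ_[p]) : Prop :=
  ∀ α ∈ S, ∀ β ∈ S, ∀ a ∈ PadicRatSet p, PNonLiouville p (α - β + a)

/-- For a sequence in `[0, 1]`, the `liminf` of the `n`-th roots is `1` iff the sequence eventually
dominates every geometric sequence of ratio less than `1`. -/
lemma liminf_rpow_one_div_eq_one_iff {b : ℕ → ℝ} (h0 : ∀ n, 0 ≤ b n) (h1 : ∀ n, b n ≤ 1) :
    liminf (fun n : ℕ => b n ^ (1 / (n : ℝ))) atTop = 1 ↔
      ∀ c : ℝ, 0 < c → c < 1 → ∀ᶠ n : ℕ in atTop, c ^ n < b n := by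
  have hle (n : ℕ) : b n ^ (1 / (n : ℝ)) ≤ 1 := Real.rpow_le_one (h0 n) (h1 n) (by positivity)
  have hbelow : IsBoundedUnder (· ≥ ·) atTop fun n : ℕ => b n ^ (1 / (n : ℝ)) :=
    isBoundedUnder_of ⟨0, fun n => Real.rpow_nonneg (h0 n) _⟩
  have hcobdd : IsCoboundedUnder (· ≥ ·) atTop fun n : ℕ => b n ^ (1 / (n : ℝ)) :=
    (isBoundedUnder_of ⟨1, hle⟩ : IsBoundedUnder (· ≤ ·) atTop _).isCoboundedUnder_ge
  have hroot {c : ℝ} (hc : 0 < c) {n : ℕ} (hn : 0 < n) :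
      c < b n ^ (1 / (n : ℝ)) ↔ c ^ n < b n := by
    rw [one_div, Real.lt_rpow_inv_iff_of_pos hc.le (h0 n) (by positivity), Real.rpow_natCast]
  constructor
  · intro h c hc hc1
    filter_upwards [eventually_lt_of_lt_liminf (h ▸ hc1) hbelow, eventually_gt_atTop 0]
      with n hn hpos
    exact (hroot hc hpos).1 hn
  · intro h
    apply le_antisymm
    · exact liminf_le_of_frequently_le (Frequently.of_forall hle) hbelow
    · refine le_of_forall_lt_imp_le_of_dense fun c hc => ?_
      refine (le_max_left c (1 / 2)).trans (le_liminf_of_le hcobdd ?_)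
      have hpos : (0 : ℝ) < max c (1 / 2) := lt_max_of_lt_right (by norm_num)
      filter_upwards [h _ hpos (max_lt hc (by norm_num)), eventually_gt_atTop 0] with n hn hn0
      exact ((hroot hpos hn0).2 hn).le

/-- A sequence in `[0, 1]` whose terms in each residue class modulo `m` are bounded below by
sequences with `n`-th roots of `liminf` equal to `1` has the same property. -/
lemma liminf_rpow_one_div_eq_one_of_residues {m : ℕ} (hm : 0 < m) {b : ℕ → ℝ} {a : ℕ → ℕ → ℝ}
    (hb0 : ∀ n, 0 ≤ b n) (hb1 : ∀ n, b n ≤ 1)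
    (ha0 : ∀ j n, 0 ≤ a j n) (ha1 : ∀ j n, a j n ≤ 1)
    (hab : ∀ n, a (n % m) (n / m) ≤ b n)
    (ha : ∀ j < m, liminf (fun n : ℕ => a j n ^ (1 / (n : ℝ))) atTop = 1) :
    liminf (fun n : ℕ => b n ^ (1 / (n : ℝ))) atTop = 1 := by
  rw [liminf_rpow_one_div_eq_one_iff hb0 hb1]
  intro c hc hc1
  have hall : ∀ᶠ k : ℕ in atTop, ∀ j ∈ Finset.range m, c ^ k < a j k := by
    rw [eventually_all_finset]
    intro j hj
    exact (liminf_rpow_one_div_eq_one_iff (ha0 j) (ha1 j)).1 (ha j (Finset.mem_range.1 hj)) c hc hc1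
  filter_upwards [(Nat.tendsto_div_const_atTop hm.ne').eventually hall] with n hn
  calc c ^ n ≤ c ^ (n / m) := pow_le_pow_of_le_one hc.le hc1.le (Nat.div_le_self n m)
    _ < a (n % m) (n / m) := hn _ (Finset.mem_range.2 (Nat.mod_lt n hm))
    _ ≤ b n := hab n

/-- (From the proof of Lemma 1.4, case r = 1.) Let `m` be a positive integer prime
to `p` and `η ∈ ℤ_[p]`. If for every integer `j` with `-m < j < m` the element
`η + j/m` of `ℤ_[p]` (the unique `x` with `m·x = j`, well defined since `m` is a
unit in `ℤ_[p]`) is p-adically non-Liouville, then `m·η` is p-adically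
non-Liouville. -/
theorem statement2 (p : ℕ) [Fact p.Prime] (m : ℕ) (hm : 0 < m) (hmp : Nat.Coprime m p)
    (η : ℤ_[p])
    (h : ∀ j : ℤ, -(m : ℤ) < j → j < (m : ℤ) →
      ∀ x : ℤ_[p], (m : ℤ_[p]) * x = (j : ℤ_[p]) → PNonLiouville p (η + x)) :
    PNonLiouville p ((m : ℤ_[p]) * η) := by
  have hnorm : ‖(m : ℤ_[p])‖ = 1 := by
    rw [PadicInt.norm_natCast_eq_one_iff]
    exact hmp.symm
  obtain ⟨u, hu⟩ := (PadicInt.isUnit_iff.2 hnorm).exists_right_inv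
  have hdiv (n : ℕ) : (n : ℤ_[p]) = m * (n / m : ℕ) + (n % m : ℕ) := by
    exact_mod_cast (Nat.div_add_mod n m).symm
  constructor
  · refine liminf_rpow_one_div_eq_one_of_residues hm
      (a := fun j n => ‖η + u * j + n‖) (fun _ => norm_nonneg _) (fun _ => PadicInt.norm_le_one _)
      (fun _ _ => norm_nonneg _) (fun _ _ => PadicInt.norm_le_one _) (fun n => ?_) fun j hj => ?_
    · have : (m : ℤ_[p]) * η + n = m * (η + u * (n % m : ℕ) + (n / m : ℕ)) := by
        linear_combination hdiv n - ((n % m : ℕ) : ℤ_[p]) * hu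
      rw [this, norm_mul, hnorm, one_mul]
    · exact (h j (by omega) (by omega) (u * j)
        (by push_cast; linear_combination (j : ℤ_[p]) * hu)).1
  · refine liminf_rpow_one_div_eq_one_of_residues hm
      (a := fun j n => ‖η + -(u * j) - n‖) (fun _ => norm_nonneg _)
      (fun _ => PadicInt.norm_le_one _) (fun _ _ => norm_nonneg _)
      (fun _ _ => PadicInt.norm_le_one _) (fun n => ?_) fun j hj => ?_
    · have : (m : ℤ_[p]) * η - n = m * (η + -(u * (n % m : ℕ)) - (n / m : ℕ)) := by
        linear_combination -hdiv n + ((n % m : ℕ) : ℤ_[p]) * hu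
      rw [this, norm_mul, hnorm, one_mul]
    · exact (h (-j) (by omega) (by omega) (-(u * j))
        (by push_cast; linear_combination -(j : ℤ_[p]) * hu)).2
end

section
/- Let e and n be positive integers with e dividing n. Let G := (ℤ × ℤ)/H, where H is the subgroup of ℤ × ℤ generated by (e, −n), and let π : ℤ × ℤ → G be the quotient map. Let M ⊆ G be the submonoid generated by π(1,0) and π(0,1), and let M^sat := {g ∈ G : k·g ∈ M for some positive integer k} be its saturation. Then there is an isomorphism of commutative monoids φ : M^sat ≅ ℕ × ℤ/eℤ satisfying φ(π(1,0)) = (n/e, 1 mod e) and φ(π(0,1)) = (1, 0). (This is the computation (ℕ ⊕_{e,ℕ,n} ℕ)^sat ≅ ℕ ⊕ ℤ/eℤ used in Remark 2.30 of the paper.) -/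
/-- The saturation `M^sat = {g ∈ G : k • g ∈ M for some positive integer k}` of a
submonoid `M` of (the underlying additive monoid of) `G`. -/
def satOf {G : Type*} [AddCommMonoid G] (M : AddSubmonoid G) : AddSubmonoid G where
  carrier := {g | ∃ k : ℕ, 0 < k ∧ k • g ∈ M}
  zero_mem' := ⟨1, Nat.one_pos, by simpa using M.zero_mem⟩
  add_mem' := by
    intro a b ha hb
    obtain ⟨k, hk, hka⟩ := ha
    obtain ⟨l, hl, hlb⟩ := hb
    refine ⟨k * l, Nat.mul_pos hk hl, ?_⟩
    have ha' : (k * l) • a = l • (k • a) := by rw [mul_comm, mul_smul]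
    have hb' : (k * l) • b = k • (l • b) := by rw [mul_smul]
    rw [smul_add, ha', hb']
    exact add_mem (M.nsmul_mem hka l) (M.nsmul_mem hlb k)

theorem mem_satOf_of_mem {G : Type*} [AddCommMonoid G] {M : AddSubmonoid G} {x : G}
    (h : x ∈ M) : x ∈ satOf M :=
  ⟨1, Nat.one_pos, by simpa using h⟩

/-- The subgroup `H ⊆ ℤ × ℤ` generated by `(e, -n)`. -/
def Hsub (e n : ℕ) : AddSubgroup (ℤ × ℤ) := AddSubgroup.zmultiples ((e : ℤ), -(n : ℤ))

/-- The group `G = (ℤ × ℤ)/H`. -/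
abbrev Gquot (e n : ℕ) : Type := (ℤ × ℤ) ⧸ Hsub e n

/-- The quotient map `π : ℤ × ℤ → G`. -/
def qmap (e n : ℕ) : ℤ × ℤ → Gquot e n := QuotientAddGroup.mk

/-- The submonoid `M ⊆ G` generated by `π(1,0)` and `π(0,1)`. -/
def Mgen (e n : ℕ) : AddSubmonoid (Gquot e n) :=
  AddSubmonoid.closure {qmap e n ((1 : ℤ), (0 : ℤ)), qmap e n ((0 : ℤ), (1 : ℤ))}

/-- The homomorphism `G → ℤ × ℤ/e` induced by `(a, b) ↦ (a * (n / e) + b, a)`. -/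
def gquotHom (e n : ℕ) (hdvd : e ∣ n) : Gquot e n →+ ℤ × ZMod e :=
  QuotientAddGroup.lift (Hsub e n)
    { toFun := fun p => (p.1 * ((n / e : ℕ) : ℤ) + p.2, (p.1 : ZMod e))
      map_zero' := by simp
      map_add' := fun p q => by
        ext
        · simp only [Prod.fst_add, Prod.snd_add]; ring
        · simp }
    (by
      rw [Hsub, AddSubgroup.zmultiples_le]
      have h : (e : ℤ) * ((n / e : ℕ) : ℤ) = n := by exact_mod_cast Nat.mul_div_cancel' hdvd
      rw [AddMonoidHom.mem_ker]
      ext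
      · simp only [AddMonoidHom.coe_mk, ZeroHom.coe_mk, h, Prod.fst_zero, add_neg_cancel]
      · simp)

theorem gquotHom_qmap (e n : ℕ) (hdvd : e ∣ n) (p : ℤ × ℤ) :
    gquotHom e n hdvd (qmap e n p) = (p.1 * ((n / e : ℕ) : ℤ) + p.2, (p.1 : ZMod e)) :=
  rfl

theorem qmap_surjective (e n : ℕ) : Function.Surjective (qmap e n) :=
  QuotientAddGroup.mk_surjective

theorem gquotHom_injective (e n : ℕ) (hdvd : e ∣ n) :
    Function.Injective (gquotHom e n hdvd) := by
  rw [injective_iff_map_eq_zero]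
  intro x hx
  obtain ⟨⟨a, b⟩, rfl⟩ := qmap_surjective e n x
  rw [gquotHom_qmap, Prod.mk_eq_zero, CharP.intCast_eq_zero_iff (ZMod e) e] at hx
  obtain ⟨h1, t, rfl⟩ := hx
  have h : (e : ℤ) * ((n / e : ℕ) : ℤ) = n := by exact_mod_cast Nat.mul_div_cancel' hdvd
  refine (QuotientAddGroup.eq_zero_iff _).2 (AddSubgroup.mem_zmultiples_iff.2 ⟨t, ?_⟩)
  ext
  · simp [mul_comm]
  · simp only [Prod.smul_mk, smul_eq_mul]
    linear_combination t * h - h1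

theorem mem_satOf_Mgen_iff (e n : ℕ) (he : 0 < e) (hdvd : e ∣ n) (x : Gquot e n) :
    x ∈ satOf (Mgen e n) ↔ 0 ≤ (gquotHom e n hdvd x).1 := by
  constructor
  · rintro ⟨k, hk, hx⟩
    have hM : ∀ y ∈ Mgen e n, 0 ≤ (gquotHom e n hdvd y).1 := by
      intro y hy
      induction hy using AddSubmonoid.closure_induction with
      | mem y hy =>
        rcases hy with rfl | rfl <;> rw [gquotHom_qmap] <;> simp only <;> positivity
      | zero => simp
      | add y z _ _ hy hz => rw [map_add]; exact add_nonneg hy hz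
    have h := hM _ hx
    rw [map_nsmul, Prod.smul_fst, nsmul_eq_mul] at h
    exact nonneg_of_mul_nonneg_right h (by exact_mod_cast hk)
  · intro hx
    refine ⟨e, he, ?_⟩
    obtain ⟨c, hc⟩ := Int.eq_ofNat_of_zero_le hx
    have key : e • x = (e * c) • qmap e n (0, 1) := by
      apply gquotHom_injective e n hdvd
      rw [map_nsmul, map_nsmul, gquotHom_qmap]
      ext
      · simp [hc]
      · simp
    rw [key]
    have hmem : qmap e n (0, 1) ∈ Mgen e n :=
      AddSubmonoid.subset_closure (Set.mem_insert_of_mem _ rfl)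
    exact AddSubmonoid.nsmul_mem _ hmem _

/-- The homomorphism `M^sat → ℕ × ℤ/e` obtained by restricting `gquotHom`. -/
def satHom (e n : ℕ) (he : 0 < e) (hdvd : e ∣ n) : satOf (Mgen e n) →+ ℕ × ZMod e where
  toFun x := ((gquotHom e n hdvd x).1.toNat, (gquotHom e n hdvd x).2)
  map_zero' := by simp
  map_add' x y := by
    have hx := (mem_satOf_Mgen_iff e n he hdvd x).1 x.2
    have hy := (mem_satOf_Mgen_iff e n he hdvd y).1 y.2
    ext
    · simp [Int.toNat_add hx hy]
    · simp

theorem satHom_bijective (e n : ℕ) (he : 0 < e) (hdvd : e ∣ n) :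
    Function.Bijective (satHom e n he hdvd) := by
  constructor
  · intro x y hxy
    have hx := (mem_satOf_Mgen_iff e n he hdvd x).1 x.2
    have hy := (mem_satOf_Mgen_iff e n he hdvd y).1 y.2
    obtain ⟨h1, h2⟩ := Prod.mk.inj hxy
    refine Subtype.ext (gquotHom_injective e n hdvd (Prod.ext ?_ h2))
    omega
  · rintro ⟨c, z⟩
    obtain ⟨a, rfl⟩ := ZMod.intCast_surjective z
    have h := gquotHom_qmap e n hdvd (a, c - a * ((n / e : ℕ) : ℤ))
    rw [add_sub_cancel] at h
    refine ⟨⟨qmap e n (a, c - a * ((n / e : ℕ) : ℤ)),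
      (mem_satOf_Mgen_iff e n he hdvd _).2 (by rw [h]; exact Int.natCast_nonneg c)⟩, ?_⟩
    simp [satHom, h, -Int.natCast_ediv]

/-- (The computation `(ℕ ⊕_{e,ℕ,n} ℕ)^sat ≅ ℕ ⊕ ℤ/eℤ` of Remark 2.30.)
Let `e ∣ n` be positive integers, `G = (ℤ × ℤ)/⟨(e, -n)⟩`, `M ⊆ G` the submonoid
generated by the classes of `(1,0)` and `(0,1)`, and `M^sat` its saturation. Then
there is a monoid isomorphism `φ : M^sat ≅ ℕ × ℤ/eℤ` with `φ(π(1,0)) = (n/e, 1)`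
and `φ(π(0,1)) = (1, 0)`. -/
theorem statement6 (e n : ℕ) (he : 0 < e) (hn : 0 < n) (hdvd : e ∣ n) :
    ∃ φ : satOf (Mgen e n) ≃+ ℕ × ZMod e,
      φ ⟨qmap e n ((1 : ℤ), (0 : ℤ)),
          mem_satOf_of_mem (AddSubmonoid.subset_closure (Set.mem_insert _ _))⟩
        = (n / e, (1 : ZMod e)) ∧
      φ ⟨qmap e n ((0 : ℤ), (1 : ℤ)),
          mem_satOf_of_mem (AddSubmonoid.subset_closure (Set.mem_insert_of_mem _ rfl))⟩
        = (1, (0 : ZMod e)) := by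
  refine ⟨AddEquiv.ofBijective (satHom e n he hdvd) (satHom_bijective e n he hdvd), ?_, ?_⟩ <;>
    rw [AddEquiv.ofBijective_apply] <;>
    simp [satHom, gquotHom_qmap, -Int.natCast_ediv]
end

section
/- Let r, c, n be positive integers. Let ℤ^{r×c} be the free abelian group on generators e_{i,j} (1 ≤ i ≤ r, 1 ≤ j ≤ c), let H be the subgroup generated by the elements n·(e_{i,j} − e_{i,1}) for all 1 ≤ i ≤ r and 2 ≤ j ≤ c, let G := ℤ^{r×c}/H with quotient map π, let M ⊆ G be the submonoid generated by all the classes π(e_{i,j}), and let M^sat := {g ∈ G : k·g ∈ M for some positive integer k}. Then there is an isomorphism of commutative monoids ψ : ℕ^r × ∏_{1 ≤ i ≤ r, 2 ≤ j ≤ c} ℤ/nℤ ≅ M^sat such that ψ(δ_i, 0) = π(e_{i,1}) for all i, and ψ(δ_i, −δ_{i,j}) = π(e_{i,j}) for all i and all 2 ≤ j ≤ c, where δ_i denotes the i-th standard generator of ℕ^r and δ_{i,j} the (i,j)-th standard generator of ∏ ℤ/nℤ. (This is the isomorphism ℕ^r ⊕ (⊕_{1≤i≤r, 2≤j≤c}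 ℤ/nℤ) ≅ Q^sat, equation (2.16), established in the proof of Proposition 2.18 of the paper.) -/
/-- The subgroup `H` of the free abelian group `ℤ^{r×c}` generated by the elements
`n·(e_{i,j} - e_{i,1})` for `1 ≤ i ≤ r` and `2 ≤ j ≤ c` (here the index `⟨0, hc⟩ : Fin c`
plays the role of `j = 1`). -/
def relSub (r c n : ℕ) (hc : 0 < c) : AddSubgroup ((Fin r × Fin c) → ℤ) :=
  AddSubgroup.closure
    {x | ∃ (i : Fin r) (j : Fin c), j ≠ ⟨0, hc⟩ ∧
      x = (n : ℤ) • (Pi.single (i, j) 1 - Pi.single (i, (⟨0, hc⟩ : Fin c)) 1)}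

/-- The quotient group `G = ℤ^{r×c}/H`. -/
abbrev G7 (r c n : ℕ) (hc : 0 < c) : Type := ((Fin r × Fin c) → ℤ) ⧸ relSub r c n hc

/-- The quotient map `π : ℤ^{r×c} → G`. -/
def q7 (r c n : ℕ) (hc : 0 < c) : ((Fin r × Fin c) → ℤ) → G7 r c n hc :=
  QuotientAddGroup.mk

/-- The submonoid `M ⊆ G` generated by the classes `π(e_{i,j})` of all standard
generators. -/
def M7 (r c n : ℕ) (hc : 0 < c) : AddSubmonoid (G7 r c n hc) :=
  AddSubmonoid.closure
    (Set.range fun ij : Fin r × Fin c => q7 r c n hc (Pi.single ij 1))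

/-- The homomorphism `ℤ^{r×c} → ℤ^r × ∏ ℤ/nℤ` recording the row sums and the negatives of the
entries outside the column `a`, reduced mod `n`. -/
def rowSumResidue {r c : ℕ} (n : ℕ) (a : Fin c) :
    ((Fin r × Fin c) → ℤ) →+ (Fin r → ℤ) × ((Fin r × {j : Fin c // j ≠ a}) → ZMod n) where
  toFun x := (fun i => ∑ j, x (i, j), fun p => -(x (p.1, p.2) : ZMod n))
  map_zero' := by ext <;> simp
  map_add' x y := by
    ext
    · simp [Finset.sum_add_distrib]
    · simp [add_comm]

lemma rowSumResidue_single_base {r c : ℕ} (n : ℕ) (a : Fin c) (i : Fin r) :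
    rowSumResidue n a (Pi.single (i, a) 1) = (Pi.single i 1, 0) := by
  ext k
  · by_cases hk : k = i
    · subst hk
      simp [rowSumResidue, Pi.single_apply, Finset.filter_eq']
    · simp [rowSumResidue, Pi.single_apply, hk]
  · simp [rowSumResidue, Pi.single_apply, k.2.2]

lemma rowSumResidue_single_ne {r c : ℕ} (n : ℕ) (a : Fin c) (i : Fin r)
    (j : {j : Fin c // j ≠ a}) :
    rowSumResidue n a (Pi.single (i, (j : Fin c)) 1) = (Pi.single i 1, -Pi.single (i, j) 1) := by
  ext k
  · by_cases hk : k = i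
    · subst hk
      simp [rowSumResidue, Pi.single_apply, Finset.filter_eq']
    · simp [rowSumResidue, Pi.single_apply, hk]
  · simp [rowSumResidue, Pi.single_apply, Prod.ext_iff, Subtype.ext_iff]

lemma rowSumResidue_surjective {r c : ℕ} (n : ℕ) (a : Fin c) :
    Function.Surjective (rowSumResidue (r := r) n a) := by
  rintro ⟨v, t⟩
  refine ⟨fun p => if h : p.2 ≠ a then -((t (p.1, ⟨p.2, h⟩)).cast : ℤ)
    else v p.1 + ∑ j : {j : Fin c // j ≠ a}, ((t (p.1, j)).cast : ℤ), ?_⟩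
  ext k
  · simp only [rowSumResidue, AddMonoidHom.coe_mk, ZeroHom.coe_mk]
    rw [Fintype.sum_eq_add_sum_subtype_ne _ a, dif_neg (by simp),
      Finset.sum_congr rfl fun (j : {j : Fin c // j ≠ a}) _ => dif_pos j.2]
    simp
  · simp [rowSumResidue, k.2.2]

lemma ker_rowSumResidue (r c n : ℕ) (hc : 0 < c) :
    (rowSumResidue (r := r) n (⟨0, hc⟩ : Fin c)).ker = relSub r c n hc := by
  apply le_antisymm
  · intro x hx
    have hx' := Prod.ext_iff.1 (AddMonoidHom.mem_ker.1 hx)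
    have hsum : ∀ i, ∑ j, x (i, j) = 0 := fun i => congrFun hx'.1 i
    have hres : ∀ i j, j ≠ (⟨0, hc⟩ : Fin c) → (n : ℤ) ∣ x (i, j) := fun i j hj => by
      have h := congrFun hx'.2 (i, ⟨j, hj⟩)
      exact (ZMod.intCast_zmod_eq_zero_iff_dvd _ _).1 (neg_eq_zero.1 h)
    have hdecomp : x = ∑ i, ∑ j, x (i, j) •
        (Pi.single (i, j) 1 - Pi.single (i, (⟨0, hc⟩ : Fin c)) 1 : (Fin r × Fin c) → ℤ) := by
      simp only [smul_sub, Finset.sum_sub_distrib, ← Finset.sum_smul, hsum, zero_smul,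
        sub_zero]
      rw [← Fintype.sum_prod_type' (f := fun i j =>
        x (i, j) • (Pi.single (i, j) 1 : (Fin r × Fin c) → ℤ))]
      exact pi_eq_sum_univ' x
    rw [hdecomp]
    refine sum_mem fun i _ => sum_mem fun j _ => ?_
    by_cases hj : j = ⟨0, hc⟩
    · simp [hj]
    · obtain ⟨m, hm⟩ := hres i j hj
      rw [hm, mul_comm, mul_smul]
      refine zsmul_mem ?_ m
      exact AddSubgroup.subset_closure ⟨i, j, hj, rfl⟩
  · refine (AddSubgroup.closure_le _).2 ?_
    rintro _ ⟨i, j, hj, rfl⟩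
    have h := rowSumResidue_single_ne n (⟨0, hc⟩ : Fin c) i ⟨j, hj⟩
    simp only at h
    rw [SetLike.mem_coe, AddMonoidHom.mem_ker, map_zsmul, map_sub, rowSumResidue_single_base, h]
    ext <;> simp

/-- The quotient `G` is `ℤ^r × ∏ ℤ/nℤ`. -/
noncomputable def rowSumResidueEquiv (r c n : ℕ) (hc : 0 < c) :
    G7 r c n hc ≃+ (Fin r → ℤ) × ((Fin r × {j : Fin c // j ≠ ⟨0, hc⟩}) → ZMod n) :=
  (QuotientAddGroup.quotientAddEquivOfEq (ker_rowSumResidue r c n hc).symm).trans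
    (QuotientAddGroup.quotientKerEquivOfSurjective _ (rowSumResidue_surjective n _))

lemma rowSumResidueEquiv_q7 (r c n : ℕ) (hc : 0 < c) (x : (Fin r × Fin c) → ℤ) :
    rowSumResidueEquiv r c n hc (q7 r c n hc x) = rowSumResidue n ⟨0, hc⟩ x :=
  rfl

lemma nonneg_of_mem_M7 {r c n : ℕ} {hc : 0 < c} {g : G7 r c n hc} (hg : g ∈ M7 r c n hc) :
    0 ≤ (rowSumResidueEquiv r c n hc g).1 := by
  induction hg using AddSubmonoid.closure_induction with
  | mem _ h =>
    obtain ⟨p, rfl⟩ := h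
    simp only [rowSumResidueEquiv_q7]
    intro i
    have hp : (0 : (Fin r × Fin c) → ℤ) ≤ Pi.single p 1 := Pi.single_nonneg.2 zero_le_one
    change 0 ≤ ∑ j, (Pi.single p 1 : (Fin r × Fin c) → ℤ) (i, j)
    exact Finset.sum_nonneg fun j _ => hp (i, j)
  | zero => simp
  | add x y _ _ hx hy =>
    rw [map_add]
    exact add_nonneg hx hy

lemma mem_satOf_M7_iff {r c n : ℕ} {hc : 0 < c} (hn : 0 < n) (g : G7 r c n hc) :
    g ∈ satOf (M7 r c n hc) ↔ 0 ≤ (rowSumResidueEquiv r c n hc g).1 := by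
  constructor
  · rintro ⟨k, hk, hkg⟩ i
    have h := nonneg_of_mem_M7 hkg i
    rw [map_nsmul] at h
    simpa [hk] using h
  · intro h
    refine ⟨n, hn, ?_⟩
    have hsum : n • g = ∑ i, (n * ((rowSumResidueEquiv r c n hc g).1 i).toNat) •
        q7 r c n hc (Pi.single (i, (⟨0, hc⟩ : Fin c)) 1) := by
      apply (rowSumResidueEquiv r c n hc).injective
      simp only [map_sum, map_nsmul, rowSumResidueEquiv_q7, rowSumResidue_single_base]
      ext k
      · have hk : 0 ≤ (rowSumResidueEquiv r c n hc g).1 k := h k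
        simp [Prod.fst_sum, Finset.sum_apply, Pi.single_apply, hk]
      · simp [Prod.snd_sum, Finset.sum_apply]
    rw [hsum]
    refine sum_mem fun i _ => nsmul_mem ?_ _
    exact AddSubmonoid.subset_closure ⟨(i, ⟨0, hc⟩), rfl⟩

/-- The embedding `ℕ^r × T → ℤ^r × T`. -/
def natCastProd (r : ℕ) (T : Type*) [AddCommMonoid T] : (Fin r → ℕ) × T →+ (Fin r → ℤ) × T :=
  ((Nat.castAddMonoidHom ℤ).compLeft (Fin r)).prodMap (AddMonoidHom.id T)

lemma natCastProd_injective (r : ℕ) (T : Type*) [AddCommMonoid T] :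
    Function.Injective (natCastProd r T) :=
  Function.Injective.prodMap (Function.Injective.comp_left (Nat.cast_injective (R := ℤ)))
    Function.injective_id

lemma natCastProd_single (r : ℕ) {T : Type*} [AddCommMonoid T] (i : Fin r) (t : T) :
    natCastProd r T (Pi.single i 1, t) = (Pi.single i 1, t) := by
  ext k
  · simp [natCastProd, Pi.single_apply]
  · rfl

/-- (Equation (2.16) in the proof of Proposition 2.18 of the paper.) There is a
monoid isomorphism `ψ : ℕ^r × ∏_{1≤i≤r, 2≤j≤c} ℤ/nℤ ≅ M^sat` with
`ψ(δᵢ, 0) = π(e_{i,1})` and `ψ(δᵢ, -δ_{i,j}) = π(e_{i,j})` for `j ≠ 1`. -/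
theorem statement7 (r c n : ℕ) (hr : 0 < r) (hc : 0 < c) (hn : 0 < n) :
    ∃ ψ : ((Fin r → ℕ) × ((Fin r × {j : Fin c // j ≠ ⟨0, hc⟩}) → ZMod n)) ≃+
        satOf (M7 r c n hc),
      (∀ i : Fin r,
        ((ψ ((Pi.single i 1 : Fin r → ℕ),
            (0 : (Fin r × {j : Fin c // j ≠ ⟨0, hc⟩}) → ZMod n)) :
          satOf (M7 r c n hc)) : G7 r c n hc)
          = q7 r c n hc (Pi.single (i, (⟨0, hc⟩ : Fin c)) 1)) ∧
      (∀ (i : Fin r) (j : {j : Fin c // j ≠ ⟨0, hc⟩}),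
        ((ψ ((Pi.single i 1 : Fin r → ℕ),
            -(Pi.single (i, j) 1 : (Fin r × {j : Fin c // j ≠ ⟨0, hc⟩}) → ZMod n)) :
          satOf (M7 r c n hc)) : G7 r c n hc)
          = q7 r c n hc (Pi.single (i, (j : Fin c)) 1)) := by
  let E := rowSumResidueEquiv r c n hc
  let ι := natCastProd r ((Fin r × {j : Fin c // j ≠ ⟨0, hc⟩}) → ZMod n)
  let θ := E.symm.toAddMonoidHom.comp ι
  have hθ : ∀ x, θ x ∈ satOf (M7 r c n hc) := fun x => by
    rw [mem_satOf_M7_iff hn]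
    change 0 ≤ (E (E.symm (ι x))).1
    rw [E.apply_symm_apply]
    exact fun i => Int.natCast_nonneg _
  have hbij : Function.Bijective (θ.codRestrict (satOf (M7 r c n hc)) hθ) := by
    constructor
    · intro x y hxy
      exact natCastProd_injective _ _ (E.symm.injective (congrArg Subtype.val hxy))
    · rintro ⟨g, hg⟩
      have hpos := (mem_satOf_M7_iff hn g).1 hg
      refine ⟨(fun i => ((E g).1 i).toNat, (E g).2), Subtype.ext ?_⟩
      refine E.symm_apply_eq.2 (Prod.ext (funext fun i => ?_) rfl)
      exact Int.toNat_of_nonneg (hpos i)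
  refine ⟨AddEquiv.ofBijective _ hbij, fun i => ?_, fun i j => ?_⟩
  · refine E.symm_apply_eq.2 ?_
    exact (natCastProd_single r i _).trans (rowSumResidue_single_base n _ i).symm
  · refine E.symm_apply_eq.2 ?_
    exact (natCastProd_single r i _).trans (rowSumResidue_single_ne n _ i j).symm
end

section
/- Let K be a field of characteristic zero, complete with respect to a nonarchimedean multiplicative absolute value ‖·‖ induced by a discrete valuation, whose residue field has characteristic p > 0 (so 0 < ‖p‖ < 1). Let σ : K → K be a ring homomorphism satisfying ‖σ(x)‖ = ‖x‖ for all x ∈ K. For a polynomial P = ∑_{i=0}^{d} a_i X^i ∈ K[X], write P^σ := ∑_{i=0}^{d} σ(a_i) X^i and P^σ(X/p) := ∑_{i=0}^{d} σ(a_i) p^{−i} X^i ∈ K[X]. If P is monic of degree d and P(X) divides P^σ(X/p) in K[X], then P(X) = X^d, i.e., all roots of P are 0. (This is the claim, established in the proof of Corollary 3.8 of the paper (the equivalence (3.17)), that an endomorphism whose minimal polynomial P satisfies the Frobenius compatibility P(x) | P^σ(x/p) is nilpotent; it shows that every locally free log convergent F-isocrystal has exponents in 0.) -/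
/-- (From the proof of Corollary 3.8 / equivalence (3.17) of the paper.)
Let `K` be a field of characteristic zero, complete with respect to a nonarchimedean
multiplicative absolute value `‖·‖` induced by a discrete valuation, whose residue
field has characteristic `p > 0` (so `0 < ‖p‖ < 1`). Let `σ : K → K` be a ring
homomorphism with `‖σ x‖ = ‖x‖` for all `x`. For `P = ∑ aᵢ Xⁱ`, write
`P^σ(X/p) = ∑ σ(aᵢ) p⁻ⁱ Xⁱ = (P.map σ).comp (C p⁻¹ * X)`. If `P` is monic of degree
`d` and `P(X)` divides `P^σ(X/p)` in `K[X]`, then `P = X^d`, i.e. all roots of `P`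
are `0`. -/
theorem statement8 {K : Type*} [NormedField K] [CompleteSpace K] [CharZero K]
    (hna : ∀ x y : K, ‖x + y‖ ≤ max ‖x‖ ‖y‖)
    (p : ℕ) (hp : p.Prime)
    (hp0 : 0 < ‖(p : K)‖) (hp1 : ‖(p : K)‖ < 1)
    (hdisc : ∃ u : K, 0 < ‖u‖ ∧ ‖u‖ < 1 ∧ ∀ x : K, x ≠ 0 → ∃ k : ℤ, ‖x‖ = ‖u‖ ^ k)
    (σ : K →+* K) (hσ : ∀ x : K, ‖σ x‖ = ‖x‖)
    (P : Polynomial K) (d : ℕ) (hmonic : P.Monic) (hdeg : P.natDegree = d)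
    (hdvd : P ∣ (P.map σ).comp (Polynomial.C ((p : K)⁻¹) * Polynomial.X)) :
    P = Polynomial.X ^ d := by
  set a : K := (p : K)⁻¹
  set Q := (P.map σ).comp (Polynomial.C a * Polynomial.X)
  have hcoeff (n : ℕ) : Q.coeff n = σ (P.coeff n) * a ^ n := by
    simp [Q, Polynomial.comp_C_mul_X_coeff]
  have hle : Q.natDegree ≤ P.natDegree := by
    rw [Polynomial.natDegree_le_iff_coeff_eq_zero]
    intro n hn
    simp [hcoeff, Polynomial.coeff_eq_zero_of_natDegree_lt hn]
  have hQ := Polynomial.eq_leadingCoeff_mul_of_monic_of_dvd_of_natDegree_le hmonic hdvd hle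
  have hmul (n : ℕ) : σ (P.coeff n) * a ^ n = Q.leadingCoeff * P.coeff n := by
    rw [← hcoeff, ← Polynomial.coeff_C_mul, ← hQ]
  have hlead : Q.leadingCoeff = a ^ d := by
    simpa [← hdeg, hmonic.coeff_natDegree] using (hmul d).symm
  have ha : 1 < ‖a‖ := by
    rw [norm_inv]
    exact (one_lt_inv₀ hp0).2 hp1
  ext n
  rw [Polynomial.coeff_X_pow]
  split_ifs with h
  · rw [h, ← hdeg, hmonic.coeff_natDegree]
  · by_contra hn
    have hnorm := congrArg norm (hmul n)
    rw [hlead, norm_mul, norm_mul, hσ, norm_pow, norm_pow, mul_comm] at hnorm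
    have hpow := mul_right_cancel₀ (norm_ne_zero_iff.2 hn) hnorm
    exact h (pow_right_injective₀ (by positivity) ha.ne' hpow)
end
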